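/- arXiv:1802.09801 — 2 statements merged into one kernel-verified Lean document; each statement's English description precedes it below -/
import Mathlib

section
/- Let G be a graph, L a linear order on V(G), and u,v,w vertices such that u ∈ WReach_i[G,L,v] and v ∈ WReach_j[G,L,w]. Then u ∈ WReach_{i+j}[G,L,w]. -/
def WReach {V : Type*} (G : SimpleGraph V) (L : V → ℕ) (r : ℕ) (v : V) : Set V :=
  {u | ∃ p : G.Walk v u, p.length ≤ r ∧ ∀ w ∈ p.support, L u ≤ L w}

/-- If `u` is weakly `i`-reachable from `v` and `v` is weakly `j`-reachable from `w`,
then `u` is weakly `(i+j)`-reachable from `w`. -/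
theorem stmt5 {V : Type*} (G : SimpleGraph V) (L : V → ℕ) (hL : Function.Injective L)
    (i j : ℕ) (u v w : V)
    (hu : u ∈ WReach G L i v) (hv : v ∈ WReach G L j w) :
    u ∈ WReach G L (i + j) w := by
  obtain ⟨p, hp, hpm⟩ := hu
  obtain ⟨q, hq, hqm⟩ := hv
  refine ⟨q.append p, ?_, ?_⟩
  · rw [SimpleGraph.Walk.length_append]
    omega
  · intro x hx
    rcases (SimpleGraph.Walk.mem_support_append_iff q p).1 hx with h | h
    · exact (hpm v p.start_mem_support).trans (hqm x h)
    · exact hpm x h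
end

section
/- Let G be a graph, L a linear order, r ∈ ℕ, S ⊆ V(G) and I a set of vertices such that WReach_r[G,L,v] ∩ I = {v} for every v ∈ I. Then for every v ∈ I, in the graph G − (WReach_r[G,L,v] \ {v}), the vertex v is at distance greater than r from every other vertex of I. -/
/-- If `I` is a set of vertices with `WReach_r[G,L,v] ∩ I = {v}` for every `v ∈ I`, then
for every `v ∈ I`, after deleting `WReach_r[G,L,v] \ {v}` from `G`, the vertex `v` is at
distance greater than `r` from every other vertex of `I`: every walk from `v` to another
vertex of `I` avoiding the deleted set has length greater than `r`. -/
theorem stmt13 {V : Type*} (G : SimpleGraph V) (L : V → ℕ) (hL : Function.Injective L)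
    (r : ℕ) (I : Set V)
    (hI : ∀ v ∈ I, WReach G L r v ∩ I = {v}) :
    ∀ v ∈ I, ∀ u ∈ I, u ≠ v → ∀ p : G.Walk v u,
      (∀ w ∈ p.support, w ∉ WReach G L r v \ {v}) → r < p.length := by
  classical
  intro v hv u hu huv p hp
  by_contra hlen
  push Not at hlen
  obtain ⟨m, hm, hmin⟩ := Finset.exists_min_image p.support.toFinset L
    ⟨v, by simp⟩
  simp only [List.mem_toFinset] at hm hmin
  have hmv : m ∈ WReach G L r v :=
    ⟨p.takeUntil m hm, (p.length_takeUntil_le hm).trans hlen,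
      fun w hw => hmin w (p.support_takeUntil_subset_support hm hw)⟩
  have hmeq : m = v := by
    by_contra hne
    exact hp m hm ⟨hmv, hne⟩
  subst hmeq
  have hmu : m ∈ WReach G L r u ∩ I :=
    ⟨⟨p.reverse, by simpa using hlen, fun w hw => hmin w (by simpa using hw)⟩, hv⟩
  rw [hI u hu] at hmu
  exact huv hmu.symm
end
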